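/- For every n ∈ ℕ, the NiA clause set C(n) is unsatisfiable: there is no interpretation (M, f, s, mx, le, zero) with M nonempty satisfying all of the clauses C1–C5 of C(n). (Semantic content of: for every n ≥ 0, C(n) derives the empty clause ⊢ by resolution.) -/

import Mathlib

/-- Numerals in the interpretation: `num 0 = zero`, `num (k+1) = s (num k)`. -/
def num {M : Type*} (s : M → M) (zero : M) : ℕ → M
  | 0 => zero
  | k + 1 => s (num s zero k)

/-- Starting from `a`, the sequence with `upperSeq (k + 1) = mx (s (upperSeq k)) (upperSeq k)`. -/
def upperSeq {M : Type*} (s : M → M) (mx : M → M → M) (a : M) : ℕ → M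
  | 0 => a
  | k + 1 => mx (s (upperSeq s mx a k)) (upperSeq s mx a k)

theorem le_of_upperSeq_le {M : Type*} {s : M → M} {mx : M → M → M} {le : M → M → Prop} {a : M}
    (hleft : ∀ a b c, le (mx a b) c → le a c) (hright : ∀ a b c, le (mx a b) c → le b c)
    {i j : ℕ} (hij : i < j) {c : M} (hc : le (upperSeq s mx a j) c) :
    le (s (upperSeq s mx a i)) c := by
  induction j, hij using Nat.le_induction with
  | base => exact hleft _ _ _ hc
  | succ j _ ih => exact ih (hright _ _ _ hc)

/-- The NiA clause set C(n) is unsatisfiable. -/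
theorem stmt13 (n : ℕ) {M : Type*} [Nonempty M] (f s : M → M) (mx : M → M → M)
    (le : M → M → Prop) (zero : M)
    (hC1 : ∀ a, le a a)
    (hC2 : ∀ a b c, le (mx a b) c → le a c)
    (hC3 : ∀ a b c, le (mx a b) c → le b c)
    (hC4 : ∀ k ≤ n, ∀ a b, ¬ (f b = num s zero k ∧ f a = num s zero k ∧ le (s b) a))
    (hC5 : ∀ a, ∃ i ≤ n, f a = num s zero i) :
    False := by
  choose g hg hfg using fun j => hC5 (upperSeq s mx zero j)
  have key : ∀ i j, i < j → g i ≠ g j := fun i j hij h =>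
    hC4 (g i) (hg i) _ _
      ⟨hfg i, h ▸ hfg j, le_of_upperSeq_le hC2 hC3 hij (hC1 (upperSeq s mx zero j))⟩
  obtain ⟨i, -, j, -, hne, h⟩ := Finset.exists_ne_map_eq_of_card_lt_of_maps_to
    (s := Finset.range (n + 2)) (t := Finset.range (n + 1)) (f := g) (by simp)
    (fun i _ => Finset.mem_coe.2 (Finset.mem_range.2 (Nat.lt_succ_of_le (hg i))))
  rcases hne.lt_or_gt with hij | hij
  · exact key i j hij h
  · exact key j i hij h.symm
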